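/- For every state-feedback policy μ : X → U and all initial states x₀, x₀' ∈ X, the decentralized policy μ_d for the multiple-requests problem satisfies J̄(μ_d, x₀) ≤ 2 · J_(μ, x₀'). In particular, the limsup average cost of μ_d is at most twice the liminf average cost of an optimal state-feedback policy from any initial state. -/

import Mathlib

open Filter Finset

/-- Distribution of the chain after `t` steps under kernel `K`, started at `x₀`:
the `t`-fold monadic bind of `K` applied to the point mass at `x₀`. -/
noncomputable def chainDist {X : Type*} (K : X → PMF X) (x₀ : X) : ℕ → PMF X
  | 0 => PMF.pure x₀
  | t + 1 => (chainDist K x₀ t).bind K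

/-- Expectation of `f` under a PMF on a finite type. -/
noncomputable def pmfExp {X : Type*} [Fintype X] (q : PMF X) (f : X → ℝ) : ℝ :=
  ∑ x, (q x).toReal * f x

/-- The average cost over periods `0,…,T` of running the Markov chain with step
kernel `K` and per-stage cost `c`, started at `x₀`. -/
noncomputable def avgCost {X : Type*} [Fintype X] (K : X → PMF X) (c : X → ℝ)
    (x₀ : X) (T : ℕ) : ℝ :=
  (1 / (T + 1 : ℝ)) * ∑ t ∈ Finset.range (T + 1), pmfExp (chainDist K x₀ t) c

/-- Injective assignments of the `n` requests to `n` distinct servers among `k`. -/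
def Assign (n k : ℕ) : Type := {u : Fin n → Fin k // Function.Injective u}

instance (n k : ℕ) : Fintype (Assign n k) := Subtype.fintype _

/-- The post-decision server positions: server `u_j` relocates to request `x̂_j`
for each `j`, other servers are unchanged. -/
noncomputable def moveServers {S : Type*} {n k : ℕ} (xh : Fin n → S) (xs : Fin k → S)
    (u : Assign n k) : Fin k → S :=
  fun i => if h : ∃ j, u.1 j = i then xh h.choose else xs i

/-- Step kernel of the stochastic `k`-server problem with `n` requests per period
under policy `μ`: the servers chosen by `μ x` relocate to the respective requests
and the next request tuple is drawn from `p`. -/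
noncomputable def multiKernel {S : Type*} {n k : ℕ} (p : PMF (Fin n → S))
    (μ : (Fin n → S) × (Fin k → S) → Assign n k)
    (x : (Fin n → S) × (Fin k → S)) : PMF ((Fin n → S) × (Fin k → S)) :=
  p.map (fun s => (s, moveServers x.1 x.2 (μ x)))

/-- Per-stage cost with `n` requests per period:
`r(x, u) = Σ_j d(x_{u_j}, x̂_j)` evaluated at `u = μ x`. -/
noncomputable def multiCost {S : Type*} [MetricSpace S] {n k : ℕ}
    (μ : (Fin n → S) × (Fin k → S) → Assign n k)
    (x : (Fin n → S) × (Fin k → S)) : ℝ :=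
  ∑ j, dist (x.2 ((μ x).1 j)) (x.1 j)

/-- The generalized `k`-median objective for `n` requests per period:
`G(m) = Σ_{s ∈ Sⁿ} p(s) · min_{u} Σ_j d(m_{u_j}, s_j)`. -/
noncomputable def multiMedian {S : Type*} [Fintype S] [MetricSpace S] {n k : ℕ}
    (hnk : n ≤ k) (p : PMF (Fin n → S)) (m : Fin k → S) : ℝ :=
  ∑ s, (p s).toReal *
    Finset.univ.inf'
      (Finset.univ_nonempty_iff.mpr ⟨⟨Fin.castLE hnk, Fin.castLE_injective hnk⟩⟩)
      (fun u : Assign n k => ∑ j, dist (m (u.1 j)) (s j))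

/-! ### Expectations under a PMF on a finite type -/

lemma pmf_sum_toReal {X : Type*} [Fintype X] (q : PMF X) : ∑ x, (q x).toReal = 1 := by
  rw [← ENNReal.toReal_sum fun x _ => q.apply_ne_top x, ← tsum_fintype (L := .unconditional X),
    q.tsum_coe, ENNReal.toReal_one]

lemma pmfExp_mono {X : Type*} [Fintype X] (q : PMF X) {f g : X → ℝ} (h : ∀ x, f x ≤ g x) :
    pmfExp q f ≤ pmfExp q g :=
  Finset.sum_le_sum fun x _ => mul_le_mul_of_nonneg_left (h x) ENNReal.toReal_nonneg

lemma pmfExp_const {X : Type*} [Fintype X] (q : PMF X) (a : ℝ) :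
    pmfExp q (fun _ => a) = a := by
  rw [pmfExp, ← Finset.sum_mul, pmf_sum_toReal, one_mul]

lemma pmfExp_add {X : Type*} [Fintype X] (q : PMF X) (f g : X → ℝ) :
    pmfExp q (fun x => f x + g x) = pmfExp q f + pmfExp q g := by
  simp only [pmfExp, mul_add, Finset.sum_add_distrib]

lemma pmfExp_const_mul {X : Type*} [Fintype X] (q : PMF X) (a : ℝ) (f : X → ℝ) :
    pmfExp q (fun x => a * f x) = a * pmfExp q f := by
  simp only [pmfExp, Finset.mul_sum, mul_left_comm]

lemma pmfExp_pure {X : Type*} [Fintype X] (a : X) (f : X → ℝ) :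
    pmfExp (PMF.pure a) f = f a := by
  classical
  rw [pmfExp, Finset.sum_eq_single a] <;> simp +contextual [PMF.pure_apply]

lemma pmfExp_bind {X Y : Type*} [Fintype X] [Fintype Y] (q : PMF X) (K : X → PMF Y)
    (f : Y → ℝ) : pmfExp (q.bind K) f = pmfExp q (fun x => pmfExp (K x) f) := by
  have key (y : Y) : ((q.bind K) y).toReal = ∑ x, (q x).toReal * (K x y).toReal := by
    rw [PMF.bind_apply, tsum_fintype, ENNReal.toReal_sum fun x _ =>
      ENNReal.mul_ne_top (q.apply_ne_top x) ((K x).apply_ne_top y)]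
    simp only [ENNReal.toReal_mul]
  simp only [pmfExp, key, Finset.sum_mul, Finset.mul_sum]
  rw [Finset.sum_comm]
  simp only [mul_assoc]

lemma pmfExp_map {X Y : Type*} [Fintype X] [Fintype Y] (q : PMF X) (h : X → Y) (f : Y → ℝ) :
    pmfExp (q.map h) f = pmfExp q (fun x => f (h x)) := by
  rw [← PMF.bind_pure_comp, pmfExp_bind]
  simp only [Function.comp_apply, pmfExp_pure]

/-! ### Average costs of finite Markov chains -/

section avgCost

variable {X : Type*} [Fintype X] {K : X → PMF X} {c : X → ℝ}

lemma pmfExp_chainDist_succ (f : X → ℝ) (x₀ : X) (t : ℕ) :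
    pmfExp (chainDist K x₀ (t + 1)) f =
      pmfExp (chainDist K x₀ t) (fun x => pmfExp (K x) f) :=
  pmfExp_bind _ _ _

lemma avgCost_eq_div (x₀ : X) (T : ℕ) :
    avgCost K c x₀ T =
      (∑ t ∈ Finset.range (T + 1), pmfExp (chainDist K x₀ t) c) / (T + 1 : ℝ) := by
  rw [avgCost, one_div_mul_eq_div]

lemma avgCost_nonneg (hc : ∀ x, 0 ≤ c x) (x₀ : X) (T : ℕ) : 0 ≤ avgCost K c x₀ T := by
  rw [avgCost_eq_div]
  refine div_nonneg (Finset.sum_nonneg fun t _ => ?_) (by positivity)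
  exact Finset.sum_nonneg fun x _ => mul_nonneg ENNReal.toReal_nonneg (hc x)

lemma avgCost_le_of_le {M : ℝ} (hM : ∀ x, c x ≤ M) (x₀ : X) (T : ℕ) :
    avgCost K c x₀ T ≤ M := by
  rw [avgCost_eq_div, div_le_iff₀ (by positivity)]
  refine (Finset.sum_le_card_nsmul _ _ M fun t _ =>
    (pmfExp_mono _ hM).trans_eq (pmfExp_const _ M)).trans_eq ?_
  rw [Finset.card_range, nsmul_eq_mul, mul_comm]
  push_cast
  ring

lemma tendsto_add_div_succ (a b : ℝ) :
    Tendsto (fun T : ℕ => a + b / (T + 1 : ℝ)) atTop (nhds a) := by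
  simpa [div_eq_mul_inv] using
    (tendsto_one_div_add_atTop_nhds_zero_nat (𝕜 := ℝ)).const_mul b |>.const_add a

/-- If every one-step expected cost is at least `a`, so is the liminf average cost. -/
lemma le_liminf_avgCost {a : ℝ} (hc : ∀ x, 0 ≤ c x) (ha : ∀ x, a ≤ pmfExp (K x) c) (x₀ : X) :
    a ≤ liminf (avgCost K c x₀) atTop := by
  have hbound (T : ℕ) : a + -a / (T + 1 : ℝ) ≤ avgCost K c x₀ T := by
    have hstep : (T : ℝ) * a ≤ ∑ t ∈ Finset.range T, pmfExp (chainDist K x₀ (t + 1)) c := by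
      refine le_of_eq_of_le ?_ (Finset.card_nsmul_le_sum _ _ a fun t _ => ?_)
      · simp
      · rw [pmfExp_chainDist_succ]
        exact (pmfExp_const _ a).symm.trans_le (pmfExp_mono _ ha)
    have hzero : 0 ≤ pmfExp (chainDist K x₀ 0) c :=
      (hc x₀).trans_eq (pmfExp_pure x₀ c).symm
    rw [avgCost_eq_div, le_div_iff₀ (by positivity), Finset.sum_range_succ', add_mul,
      div_mul_cancel₀ _ (by positivity)]
    linarith
  obtain ⟨M, hM⟩ := (Set.finite_range c).bddAbove
  rw [← (tendsto_add_div_succ a (-a)).liminf_eq]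
  refine liminf_le_liminf (Eventually.of_forall hbound)
    (tendsto_add_div_succ a (-a)).isBoundedUnder_ge ?_
  exact (isBoundedUnder_of ⟨M, avgCost_le_of_le (fun x => hM ⟨x, rfl⟩) x₀⟩ :
    IsBoundedUnder (· ≤ ·) atTop (avgCost K c x₀)).isCoboundedUnder_ge

/-- A nonnegative potential `Φ` whose drift plus the stage cost is at most `h` bounds the
limsup average cost by any bound on the one-step expectations of `h`. -/
lemma limsup_avgCost_le_of_potential {Φ h : X → ℝ} {a : ℝ} (hc : ∀ x, 0 ≤ c x)
    (hΦ : ∀ x, 0 ≤ Φ x) (hdrift : ∀ x, c x + pmfExp (K x) Φ ≤ Φ x + h x)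
    (ha : ∀ x, pmfExp (K x) h ≤ a) (x₀ : X) :
    limsup (avgCost K c x₀) atTop ≤ a := by
  have hchain (t : ℕ) : pmfExp (chainDist K x₀ t) c + pmfExp (chainDist K x₀ (t + 1)) Φ ≤
      pmfExp (chainDist K x₀ t) Φ + pmfExp (chainDist K x₀ t) h := by
    rw [pmfExp_chainDist_succ, ← pmfExp_add, ← pmfExp_add]
    exact pmfExp_mono _ hdrift
  have htelescope (T : ℕ) : ∑ t ∈ Finset.range (T + 1), pmfExp (chainDist K x₀ t) c +
      pmfExp (chainDist K x₀ (T + 1)) Φ ≤ Φ x₀ + h x₀ + T * a := by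
    induction T with
    | zero =>
      have h0 := hchain 0
      have hpure (f : X → ℝ) : pmfExp (chainDist K x₀ 0) f = f x₀ := pmfExp_pure x₀ f
      rw [hpure Φ, hpure h] at h0
      simpa using h0
    | succ T ih =>
      have hT : pmfExp (chainDist K x₀ (T + 1)) h ≤ a := by
        rw [pmfExp_chainDist_succ]
        exact (pmfExp_mono _ ha).trans_eq (pmfExp_const _ a)
      rw [Finset.sum_range_succ]
      push_cast
      linarith [hchain (T + 1)]
  have hbound (T : ℕ) : avgCost K c x₀ T ≤ a + (Φ x₀ + h x₀ - a) / (T + 1 : ℝ) := by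
    have hpos : 0 ≤ pmfExp (chainDist K x₀ (T + 1)) Φ :=
      Finset.sum_nonneg fun x _ => mul_nonneg ENNReal.toReal_nonneg (hΦ x)
    rw [avgCost_eq_div, div_le_iff₀ (by positivity), add_mul, div_mul_cancel₀ _ (by positivity)]
    linarith [htelescope T]
  rw [← (tendsto_add_div_succ a (Φ x₀ + h x₀ - a)).limsup_eq]
  refine limsup_le_limsup (Eventually.of_forall hbound) ?_
    (tendsto_add_div_succ a (Φ x₀ + h x₀ - a)).isBoundedUnder_le
  exact (isBoundedUnder_of ⟨0, avgCost_nonneg hc x₀⟩ :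
    IsBoundedUnder (· ≥ ·) atTop (avgCost K c x₀)).isCoboundedUnder_le

end avgCost

/-! ### The `k`-server chain -/

section kServer

variable {S : Type*} {n k : ℕ}

lemma moveServers_apply_assigned (xh : Fin n → S) (xs : Fin k → S) (u : Assign n k) (j : Fin n) :
    moveServers xh xs u (u.1 j) = xh j := by
  have hex : ∃ i, u.1 i = u.1 j := ⟨j, rfl⟩
  rw [moveServers, dif_pos hex, u.2 hex.choose_spec]

lemma moveServers_apply_of_notMem_range (xh : Fin n → S) (xs : Fin k → S) (u : Assign n k)
    {i : Fin k} (hi : i ∉ Set.range u.1) : moveServers xh xs u i = xs i :=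
  dif_neg hi

lemma pmfExp_multiKernel [Fintype S] (p : PMF (Fin n → S))
    (μ : (Fin n → S) × (Fin k → S) → Assign n k) (x : (Fin n → S) × (Fin k → S))
    (f : (Fin n → S) × (Fin k → S) → ℝ) :
    pmfExp (multiKernel p μ x) f = pmfExp p (fun s => f (s, moveServers x.1 x.2 (μ x))) :=
  pmfExp_map _ _ _

variable [MetricSpace S]

lemma multiCost_nonneg (μ : (Fin n → S) × (Fin k → S) → Assign n k)
    (x : (Fin n → S) × (Fin k → S)) : 0 ≤ multiCost μ x :=
  Finset.sum_nonneg fun _ _ => dist_nonneg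

/-- Relocating servers changes the total distance to `m` only through the assigned servers. -/
lemma sum_dist_moveServers (xh : Fin n → S) (xs m : Fin k → S) (u : Assign n k) :
    ∑ i, dist (moveServers xh xs u i) (m i) + ∑ j, dist (xs (u.1 j)) (m (u.1 j)) =
      ∑ i, dist (xs i) (m i) + ∑ j, dist (xh j) (m (u.1 j)) := by
  have hdiff := Fintype.sum_of_injective u.1 u.2
    (fun j => dist (xh j) (m (u.1 j)) - dist (xs (u.1 j)) (m (u.1 j)))
    (fun i => dist (moveServers xh xs u i) (m i) - dist (xs i) (m i))
    (fun i hi => by simp only [moveServers_apply_of_notMem_range xh xs u hi, sub_self])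
    (fun j => by simp only [moveServers_apply_assigned])
  simp only [Finset.sum_sub_distrib] at hdiff
  linarith

/-- The stage cost plus the new total distance to `m` is at most the old total distance plus
twice the cost of the same assignment from `m`. -/
lemma sum_dist_add_sum_dist_moveServers_le (xh : Fin n → S) (xs m : Fin k → S)
    (u : Assign n k) :
    ∑ j, dist (xs (u.1 j)) (xh j) + ∑ i, dist (moveServers xh xs u i) (m i) ≤
      ∑ i, dist (xs i) (m i) + 2 * ∑ j, dist (m (u.1 j)) (xh j) := by
  have htri : ∑ j, dist (xs (u.1 j)) (xh j) ≤
      ∑ j, dist (xs (u.1 j)) (m (u.1 j)) + ∑ j, dist (m (u.1 j)) (xh j) := by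
    rw [← Finset.sum_add_distrib]
    exact Finset.sum_le_sum fun j _ => dist_triangle _ _ _
  have hmove := sum_dist_moveServers xh xs m u
  simp only [dist_comm (xh _)] at hmove
  linarith

lemma multiMedian_le_pmfExp_multiCost [Fintype S] (hnk : n ≤ k) (p : PMF (Fin n → S))
    (μ : (Fin n → S) × (Fin k → S) → Assign n k) (x : (Fin n → S) × (Fin k → S)) :
    multiMedian hnk p (moveServers x.1 x.2 (μ x)) ≤
      pmfExp (multiKernel p μ x) (multiCost μ) := by
  rw [pmfExp_multiKernel]
  exact pmfExp_mono p fun s => Finset.inf'_le _ (Finset.mem_univ _)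

lemma pmfExp_assignment_cost_le_multiMedian [Fintype S] (hnk : n ≤ k) (p : PMF (Fin n → S))
    (m : Fin k → S) (μ : (Fin n → S) × (Fin k → S) → Assign n k)
    (hμ : ∀ x : (Fin n → S) × (Fin k → S), ∀ v : Assign n k,
      ∑ j, dist (m ((μ x).1 j)) (x.1 j) ≤ ∑ j, dist (m (v.1 j)) (x.1 j))
    (x : (Fin n → S) × (Fin k → S)) :
    pmfExp (multiKernel p μ x) (fun y => ∑ j, dist (m ((μ y).1 j)) (y.1 j)) ≤
      multiMedian hnk p m := by
  rw [pmfExp_multiKernel]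
  exact pmfExp_mono p fun s => Finset.le_inf' _ _ fun v _ => hμ (s, _) v

end kServer

/-- For the stochastic `k`-server problem with `n` requests per period, the
decentralized policy (which assigns requests to servers via a minimum-cost injective
matching of requests to the optimal medians) has limsup average cost at most twice
the liminf average cost of any state-feedback policy. -/
theorem multi_decentralized_policy_within_factor_two
    {S : Type*} [Fintype S] [Nonempty S] [MetricSpace S] {n k : ℕ}
    (hn : 0 < n) (hnk : n ≤ k) (p : PMF (Fin n → S))
    (mstar : Fin k → S)
    (hmstar : ∀ m : Fin k → S, multiMedian hnk p mstar ≤ multiMedian hnk p m)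
    (μd : (Fin n → S) × (Fin k → S) → Assign n k)
    (hμd : ∀ x : (Fin n → S) × (Fin k → S), ∀ v : Assign n k,
      ∑ j, dist (mstar ((μd x).1 j)) (x.1 j) ≤ ∑ j, dist (mstar (v.1 j)) (x.1 j))
    (hdec : ∀ x y : (Fin n → S) × (Fin k → S), x.1 = y.1 → μd x = μd y)
    (μ : (Fin n → S) × (Fin k → S) → Assign n k)
    (x₀ x₀' : (Fin n → S) × (Fin k → S)) :
    limsup (avgCost (multiKernel p μd) (multiCost μd) x₀) atTop ≤
      2 * liminf (avgCost (multiKernel p μ) (multiCost μ) x₀') atTop := by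
  have hlower : multiMedian hnk p mstar ≤
      liminf (avgCost (multiKernel p μ) (multiCost μ) x₀') atTop :=
    le_liminf_avgCost (multiCost_nonneg μ)
      (fun x => (hmstar _).trans (multiMedian_le_pmfExp_multiCost hnk p μ x)) x₀'
  have hupper : limsup (avgCost (multiKernel p μd) (multiCost μd) x₀) atTop ≤
      2 * multiMedian hnk p mstar := by
    refine limsup_avgCost_le_of_potential (Φ := fun x => ∑ i, dist (x.2 i) (mstar i))
      (h := fun x => 2 * ∑ j, dist (mstar ((μd x).1 j)) (x.1 j)) (multiCost_nonneg μd)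
      (fun x => Finset.sum_nonneg fun _ _ => dist_nonneg) (fun x => ?_) (fun x => ?_) x₀
    · simp only [pmfExp_multiKernel, pmfExp_const]
      exact sum_dist_add_sum_dist_moveServers_le x.1 x.2 mstar (μd x)
    · rw [pmfExp_const_mul]
      exact mul_le_mul_of_nonneg_left
        (pmfExp_assignment_cost_le_multiMedian hnk p mstar μd hμd x) zero_le_two
  linarith
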